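/- arXiv:1502.07809 — 12 statements merged into one kernel-verified Lean document; each statement's English description precedes it below -/
import Mathlib

section
/- For every horizon T ≥ 0, every client index i ∈ {1,…,N}, and every state x ∈ ℕ^N, the finite-horizon optimal cost satisfies V_T(x_1,…,x_{i-1}, τ_i + x_i, x_{i+1},…,x_N) = x_i + V_T(x_1,…,x_{i-1}, τ_i, x_{i+1},…,x_N). -/
open Finset

/-- Probability weight of the delivery-outcome vector `d` (coordinate `n` delivers iff
`d n = true`) when action `u` is taken: coordinates are independent; if `u n = true` the
packet of client `n` is delivered with probability `p n`, otherwise it is never delivered. -/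
noncomputable def deliveryWeight {N : ℕ} (p : Fin N → ℝ) (u d : Fin N → Bool) : ℝ :=
  ∏ n, (if u n then (if d n then p n else 1 - p n) else (if d n then 0 else 1))

/-- The next state: `0` for a client whose packet was delivered, `x n + 1` otherwise. -/
def nextState {N : ℕ} (x : Fin N → ℕ) (d : Fin N → Bool) : Fin N → ℕ :=
  fun n => if d n then 0 else x n + 1

/-- Admissible actions: subsets of at most `L` clients allowed to transmit. -/
def admissible (N L : ℕ) : Finset (Fin N → Bool) :=
  Finset.univ.filter (fun u => (Finset.univ.filter (fun n => u n = true)).card ≤ L)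

lemma admissible_nonempty (N L : ℕ) : (admissible N L).Nonempty :=
  ⟨fun _ => false, by simp [admissible]⟩

/-- The finite-horizon optimal cost `V T x` of MDP-1, defined by the dynamic-programming
recursion: `V 0 x = ∑ n max(x n − τ n, 0)` and
`V (T+1) x = min over admissible u of [η ∑ E n u n + E(∑ max(x n + 1 − τ n,0) 1{Y n = 0} + V T Y)]`. -/
noncomputable def V {N : ℕ} (p : Fin N → ℝ) (τ : Fin N → ℕ) (E : Fin N → ℝ) (η : ℝ)
    (L : ℕ) : ℕ → (Fin N → ℕ) → ℝ
  | 0, x => ∑ n, ((x n - τ n : ℕ) : ℝ)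
  | T + 1, x =>
      (admissible N L).inf' (admissible_nonempty N L) (fun u =>
        η * ∑ n, E n * (if u n then 1 else 0) +
        ∑ d : Fin N → Bool, deliveryWeight p u d *
          ((∑ n, ((x n + 1 - τ n : ℕ) : ℝ) * (if nextState x d n = 0 then 1 else 0)) +
            V p τ E η L T (nextState x d)))

/-- The delivery weights of a fixed action sum to one. -/
lemma sum_deliveryWeight {N : ℕ} (p : Fin N → ℝ) (u : Fin N → Bool) :
    ∑ d : Fin N → Bool, deliveryWeight p u d = 1 := by
  unfold deliveryWeight
  rw [← Fintype.prod_sum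
    (fun n (b : Bool) => if u n then (if b then p n else 1 - p n) else (if b then 0 else 1))]
  refine Finset.prod_eq_one fun n _ => ?_
  cases u n <;> simp

lemma nextState_eq_zero_iff {N : ℕ} (x : Fin N → ℕ) (d : Fin N → Bool) (n : Fin N) :
    nextState x d n = 0 ↔ d n = true := by
  cases h : d n <;> simp [nextState, h]

lemma nextState_update {N : ℕ} (x : Fin N → ℕ) (d : Fin N → Bool) (i : Fin N) (a : ℕ) :
    nextState (Function.update x i a) d =
      Function.update (nextState x d) i (if d i then 0 else a + 1) := by
  funext n
  by_cases h : n = i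
  · subst h
    simp [nextState]
  · simp [nextState, h]

/-- A sum whose `i`-th term is the only one depending on the updated coordinate. -/
lemma sum_update_sub {N : ℕ} (f : Fin N → ℕ → ℝ) (x : Fin N → ℕ) (i : Fin N) (a b : ℕ) :
    ∑ n, f n (Function.update x i a n) =
      (f i a - f i b) + ∑ n, f n (Function.update x i b n) := by
  rw [← Finset.add_sum_erase _ _ (Finset.mem_univ i),
    ← Finset.add_sum_erase _ (fun n => f n (Function.update x i b n)) (Finset.mem_univ i)]
  have h : ∑ n ∈ Finset.univ.erase i, f n (Function.update x i a n) =
      ∑ n ∈ Finset.univ.erase i, f n (Function.update x i b n) :=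
    Finset.sum_congr rfl fun n hn => by
      simp [Function.update_of_ne (Finset.ne_of_mem_erase hn)]
  rw [h]
  simp only [Function.update_self]
  ring

/-- Beyond its threshold, each coordinate contributes additively to the optimal cost. -/
lemma V_update_add {N : ℕ} (p : Fin N → ℝ) (τ : Fin N → ℕ) (E : Fin N → ℝ) (η : ℝ) (L : ℕ)
    (T : ℕ) (i : Fin N) (x : Fin N → ℕ) (k : ℕ) :
    V p τ E η L T (Function.update x i (τ i + k)) =
      (k : ℝ) + V p τ E η L T (Function.update x i (τ i)) := by
  induction T generalizing x k with
  | zero =>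
    simp only [V]
    rw [sum_update_sub (fun n a => ((a - τ n : ℕ) : ℝ)) x i (τ i + k) (τ i)]
    simp
  | succ T ih =>
    have outcome (d : Fin N → Bool) :
        (∑ n, ((Function.update x i (τ i + k) n + 1 - τ n : ℕ) : ℝ) *
            (if nextState (Function.update x i (τ i + k)) d n = 0 then 1 else 0)) +
          V p τ E η L T (nextState (Function.update x i (τ i + k)) d) =
        (k : ℝ) + ((∑ n, ((Function.update x i (τ i) n + 1 - τ n : ℕ) : ℝ) *
            (if nextState (Function.update x i (τ i)) d n = 0 then 1 else 0)) +
          V p τ E η L T (nextState (Function.update x i (τ i)) d)) := by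
      simp only [nextState_eq_zero_iff]
      rw [nextState_update, nextState_update]
      rw [sum_update_sub (fun n a => ((a + 1 - τ n : ℕ) : ℝ) * (if d n = true then 1 else 0))
        x i (τ i + k) (τ i)]
      have h1 : τ i + k + 1 - τ i = k + 1 := by omega
      have h2 : τ i + 1 - τ i = 1 := by omega
      rw [h1, h2]
      cases d i
      · simp only [Bool.false_eq_true, if_false]
        rw [add_assoc (τ i) k 1, ih, ih _ 1]
        push_cast
        ring
      · simp only [if_true]
        push_cast
        ring
    simp only [V, outcome]
    have action (u : Fin N → Bool) (g : (Fin N → Bool) → ℝ) (c : ℝ) :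
        c + ∑ d, deliveryWeight p u d * ((k : ℝ) + g d) =
          (k : ℝ) + (c + ∑ d, deliveryWeight p u d * g d) := by
      simp only [mul_add, Finset.sum_add_distrib, ← Finset.sum_mul, sum_deliveryWeight]
      ring
    simp only [action]
    exact (map_finset_inf' (OrderIso.addLeft (k : ℝ)) (admissible_nonempty N L) _).symm

/-- For every horizon `T`, client `i`, and state `x`,
`V_T(x₁,…,τᵢ + xᵢ,…,x_N) = xᵢ + V_T(x₁,…,τᵢ,…,x_N)`. -/
theorem statement0 (N : ℕ) (hN : 1 ≤ N) (L : ℕ) (hL1 : 1 ≤ L) (hLN : L ≤ N)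
    (p : Fin N → ℝ) (hp : ∀ n, 0 < p n ∧ p n < 1)
    (τ : Fin N → ℕ) (hτ : ∀ n, 1 ≤ τ n)
    (E : Fin N → ℝ) (hE : ∀ n, 0 ≤ E n)
    (η : ℝ) (hη : 0 ≤ η)
    (T : ℕ) (i : Fin N) (x : Fin N → ℕ) :
    V p τ E η L T (Function.update x i (τ i + x i)) =
      (x i : ℝ) + V p τ E η L T (Function.update x i (τ i)) := by
  exact V_update_add p τ E η L T i x (x i)
end

section
/- For every horizon T ≥ 1, every client index i ∈ {1,…,N}, and every state x ∈ ℕ^N, an admissible action u attains the minimum in the dynamic-programming recursion defining V_T at the state (x_1,…,x_{i-1}, τ_i + x_i, x_{i+1},…,x_N) if and only if u attains the minimum in the recursion at the state (x_1,…,x_{i-1}, τ_i, x_{i+1},…,x_N). -/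
open Finset

/-- The quantity minimized in the dynamic-programming recursion defining `V (T+1) x`:
the cost of taking action `u` in state `x` with `T` steps to go afterwards. -/
noncomputable def Qval {N : ℕ} (p : Fin N → ℝ) (τ : Fin N → ℕ) (E : Fin N → ℝ) (η : ℝ)
    (L : ℕ) (T : ℕ) (x : Fin N → ℕ) (u : Fin N → Bool) : ℝ :=
  η * ∑ n, E n * (if u n then 1 else 0) +
    ∑ d : Fin N → Bool, deliveryWeight p u d *
      ((∑ n, ((x n + 1 - τ n : ℕ) : ℝ) * (if nextState x d n = 0 then 1 else 0)) +
        V p τ E η L T (nextState x d))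

lemma V_succ_eq_inf'_Qval {N : ℕ} (p : Fin N → ℝ) (τ : Fin N → ℕ) (E : Fin N → ℝ) (η : ℝ)
    (L T : ℕ) (x : Fin N → ℕ) :
    V p τ E η L (T + 1) x =
      (admissible N L).inf' (admissible_nonempty N L) (Qval p τ E η L T x) :=
  rfl

lemma Finset.inf'_add_const {ι : Type*} (s : Finset ι) (hs : s.Nonempty) (f : ι → ℝ) (c : ℝ) :
    s.inf' hs (fun a => f a + c) = s.inf' hs f + c :=
  (Finset.apply_inf'_eq_inf'_comp hs (fun a : ℝ => a + c)
    fun a b => (min_add_add_right a b c).symm).symm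

/-- Shifting a coordinate beyond its threshold shifts each term of the expectation. -/
lemma stageCost_add_of_shift {N : ℕ} (τ : Fin N → ℕ) (W : (Fin N → ℕ) → ℝ) (i : Fin N) (k : ℕ)
    (hW : ∀ x : Fin N → ℕ, τ i ≤ x i → W (Function.update x i (x i + k)) = W x + k)
    (x : Fin N → ℕ) (hx : τ i ≤ x i) (d : Fin N → Bool) :
    (∑ n, ((Function.update x i (x i + k) n + 1 - τ n : ℕ) : ℝ) *
        (if nextState (Function.update x i (x i + k)) d n = 0 then 1 else 0)) +
        W (nextState (Function.update x i (x i + k)) d) =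
      (∑ n, ((x n + 1 - τ n : ℕ) : ℝ) * (if nextState x d n = 0 then 1 else 0)) +
        W (nextState x d) + k := by
  by_cases hd : d i = true
  · have hnext : nextState (Function.update x i (x i + k)) d = nextState x d := by
      funext n
      by_cases hn : n = i
      · subst hn; simp [nextState, hd]
      · simp [nextState, hn]
    have hsum : (∑ n, ((Function.update x i (x i + k) n + 1 - τ n : ℕ) : ℝ) *
        (if nextState x d n = 0 then 1 else 0)) =
        ∑ n, (((x n + 1 - τ n : ℕ) : ℝ) * (if nextState x d n = 0 then 1 else 0) +
          if n = i then (k : ℝ) else 0) := by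
      refine Finset.sum_congr rfl fun n _ => ?_
      by_cases hn : n = i
      · subst hn
        have h : x n + k + 1 - τ n = x n + 1 - τ n + k := by omega
        simp [nextState, hd, h]
      · simp [hn]
    rw [hnext, hsum, Finset.sum_add_distrib]
    simp
    ring
  · have hnext : nextState (Function.update x i (x i + k)) d =
        Function.update (nextState x d) i (nextState x d i + k) := by
      funext n
      by_cases hn : n = i
      · subst hn; simp [nextState, hd]; omega
      · simp [nextState, hn]
    have hsum : (∑ n, ((Function.update x i (x i + k) n + 1 - τ n : ℕ) : ℝ) *
        (if nextState (Function.update x i (x i + k)) d n = 0 then 1 else 0)) =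
        ∑ n, ((x n + 1 - τ n : ℕ) : ℝ) * (if nextState x d n = 0 then 1 else 0) := by
      refine Finset.sum_congr rfl fun n _ => ?_
      by_cases hn : n = i
      · subst hn; simp [nextState, hd]
      · simp [nextState, hn]
    have hle : τ i ≤ nextState x d i := by
      simp [nextState, hd]; omega
    rw [hsum, hnext, hW _ hle]
    ring

lemma Qval_add_of_shift {N : ℕ} (p : Fin N → ℝ) (τ : Fin N → ℕ) (E : Fin N → ℝ) (η : ℝ)
    (L T : ℕ) (i : Fin N) (k : ℕ)
    (hV : ∀ x : Fin N → ℕ, τ i ≤ x i →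
      V p τ E η L T (Function.update x i (x i + k)) = V p τ E η L T x + k)
    (x : Fin N → ℕ) (hx : τ i ≤ x i) (u : Fin N → Bool) :
    Qval p τ E η L T (Function.update x i (x i + k)) u = Qval p τ E η L T x u + k := by
  unfold Qval
  simp_rw [stageCost_add_of_shift τ (V p τ E η L T) i k hV x hx, mul_add _ _ (k : ℝ)]
  rw [Finset.sum_add_distrib, ← Finset.sum_mul, sum_deliveryWeight, one_mul, add_assoc]

/-- Beyond the threshold, the optimal cost is affine with slope one in each coordinate. -/
lemma V_add_of_shift {N : ℕ} (p : Fin N → ℝ) (τ : Fin N → ℕ) (E : Fin N → ℝ) (η : ℝ)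
    (L T : ℕ) (i : Fin N) (k : ℕ) (x : Fin N → ℕ) (hx : τ i ≤ x i) :
    V p τ E η L T (Function.update x i (x i + k)) = V p τ E η L T x + k := by
  induction T generalizing x with
  | zero =>
    have hsum : (∑ n, ((Function.update x i (x i + k) n - τ n : ℕ) : ℝ)) =
        ∑ n, (((x n - τ n : ℕ) : ℝ) + if n = i then (k : ℝ) else 0) := by
      refine Finset.sum_congr rfl fun n _ => ?_
      by_cases hn : n = i
      · subst hn
        have h : x n + k - τ n = x n - τ n + k := by omega
        simp [h]
      · simp [hn]
    simp only [V]
    rw [hsum, Finset.sum_add_distrib]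
    simp
  | succ T ih =>
    rw [V_succ_eq_inf'_Qval, V_succ_eq_inf'_Qval, ← Finset.inf'_add_const]
    exact Finset.inf'_congr _ rfl fun u _ => Qval_add_of_shift p τ E η L T i k ih x hx u

/-- for every horizon `T + 1 ≥ 1`, client `i` and state `x`, an admissible
action `u` attains the minimum in the DP recursion at the state `(x₁,…,τᵢ + xᵢ,…,x_N)`
iff it attains the minimum in the recursion at the state `(x₁,…,τᵢ,…,x_N)`. -/
theorem statement1 (N : ℕ) (hN : 1 ≤ N) (L : ℕ) (hL1 : 1 ≤ L) (hLN : L ≤ N)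
    (p : Fin N → ℝ) (hp : ∀ n, 0 < p n ∧ p n < 1)
    (τ : Fin N → ℕ) (hτ : ∀ n, 1 ≤ τ n)
    (E : Fin N → ℝ) (hE : ∀ n, 0 ≤ E n)
    (η : ℝ) (hη : 0 ≤ η)
    (T : ℕ) (i : Fin N) (x : Fin N → ℕ) (u : Fin N → Bool) (hu : u ∈ admissible N L) :
    Qval p τ E η L T (Function.update x i (τ i + x i)) u =
        V p τ E η L (T + 1) (Function.update x i (τ i + x i)) ↔
      Qval p τ E η L T (Function.update x i (τ i)) u =
        V p τ E η L (T + 1) (Function.update x i (τ i)) := by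
  have hupd : Function.update x i (τ i + x i) =
      Function.update (Function.update x i (τ i)) i (Function.update x i (τ i) i + x i) := by
    simp
  have hle : τ i ≤ Function.update x i (τ i) i := by simp
  rw [hupd, V_add_of_shift p τ E η L (T + 1) i (x i) _ hle,
    Qval_add_of_shift p τ E η L T i (x i) (V_add_of_shift p τ E η L T i (x i)) _ hle,
    add_left_inj]
end

section
/- For every horizon T ≥ 0 and every state x ∈ ℕ^N, V_T(x) = Σ_n max(x_n − τ_n, 0) + V_T(x ∧ τ), where (x ∧ τ)_n := min(x_n, τ_n). -/
open Finset

lemma min_nextState_min {N : ℕ} (τ x : Fin N → ℕ) (d : Fin N → Bool) :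
    (fun n => min (nextState (fun m => min (x m) (τ m)) d n) (τ n)) =
      fun n => min (nextState x d n) (τ n) := by
  funext n
  unfold nextState
  split_ifs
  · rfl
  · dsimp only
    omega

/-- The penalty charged at delivery plus the excess of the next state over the thresholds
does not depend on which packets are delivered. -/
lemma sum_penalty_add_sum_excess {N : ℕ} (τ x : Fin N → ℕ) (d : Fin N → Bool) :
    (∑ n, ((x n + 1 - τ n : ℕ) : ℝ) * (if nextState x d n = 0 then 1 else 0)) +
      ∑ n, ((nextState x d n - τ n : ℕ) : ℝ) = ∑ n, ((x n + 1 - τ n : ℕ) : ℝ) := by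
  rw [← Finset.sum_add_distrib]
  refine Finset.sum_congr rfl fun n _ => ?_
  cases h : d n <;> simp [nextState, h]

lemma sum_succ_excess {N : ℕ} (τ x : Fin N → ℕ) :
    ∑ n, ((x n + 1 - τ n : ℕ) : ℝ) =
      ∑ n, ((x n - τ n : ℕ) : ℝ) + ∑ n, ((min (x n) (τ n) + 1 - τ n : ℕ) : ℝ) := by
  rw [← Finset.sum_add_distrib]
  refine Finset.sum_congr rfl fun n _ => ?_
  norm_cast
  omega

lemma V_eq_sum_excess_add_V_min {N : ℕ} (p : Fin N → ℝ) (τ : Fin N → ℕ) (E : Fin N → ℝ)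
    (η : ℝ) (L T : ℕ) (x : Fin N → ℕ) :
    V p τ E η L T x =
      (∑ n, ((x n - τ n : ℕ) : ℝ)) + V p τ E η L T (fun n => min (x n) (τ n)) := by
  induction T generalizing x with
  | zero => simp [V]
  | succ T ih =>
    have stage (y : Fin N → ℕ) (d : Fin N → Bool) :
        (∑ n, ((y n + 1 - τ n : ℕ) : ℝ) * (if nextState y d n = 0 then 1 else 0)) +
            V p τ E η L T (nextState y d) =
          ∑ n, ((y n + 1 - τ n : ℕ) : ℝ) +
            V p τ E η L T (fun n => min (nextState y d n) (τ n)) := by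
      rw [ih (nextState y d), ← add_assoc, sum_penalty_add_sum_excess]
    simp only [V]
    set c := ∑ n, ((x n - τ n : ℕ) : ℝ) with hc
    change _ = OrderIso.addLeft c _
    rw [map_finset_inf']
    refine Finset.inf'_congr _ rfl fun u _ => ?_
    have expand (d : Fin N → Bool) :=
      (stage x d).trans (congrArg (· + _) (sum_succ_excess τ x))
    simp only [Function.comp_apply, OrderIso.addLeft_apply, expand,
      stage (fun n => min (x n) (τ n)), min_nextState_min, ← hc, add_assoc c, mul_add _ c,
      Finset.sum_add_distrib, ← Finset.sum_mul, sum_deliveryWeight, one_mul]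
    ring

/-- `V_T(x) = ∑ₙ max(xₙ − τₙ, 0) + V_T(x ∧ τ)` where `(x ∧ τ)ₙ = min(xₙ, τₙ)`. -/
theorem statement2 (N : ℕ) (hN : 1 ≤ N) (L : ℕ) (hL1 : 1 ≤ L) (hLN : L ≤ N)
    (p : Fin N → ℝ) (hp : ∀ n, 0 < p n ∧ p n < 1)
    (τ : Fin N → ℕ) (hτ : ∀ n, 1 ≤ τ n)
    (E : Fin N → ℝ) (hE : ∀ n, 0 ≤ E n)
    (η : ℝ) (hη : 0 ≤ η)
    (T : ℕ) (x : Fin N → ℕ) :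
    V p τ E η L T x =
      (∑ n, ((x n - τ n : ℕ) : ℝ)) + V p τ E η L T (fun n => min (x n) (τ n)) := by
  exact V_eq_sum_excess_add_V_min p τ E η L T x
end

section
/- For every horizon T ≥ 1 and every state x ∈ ℕ^N with x_n ≤ τ_n for all n, the finite-horizon optimal cost satisfies V_T(x) = min over admissible u of [ Σ_n ( η E_n u_n + 1{x_n = τ_n} ) + E( V_{T−1}(Y ∧ τ) ) ], where Y is the random next state from (x, u) and (Y ∧ τ)_n := min(Y_n, τ_n). -/
open Finset

/-- The age charged on delivery plus the excess of the next state over the threshold does not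
depend on whether the delivery takes place. -/
lemma charge_add_excess_nextState {N : ℕ} (τ x : Fin N → ℕ) (d : Fin N → Bool) (n : Fin N) :
    ((x n + 1 - τ n : ℕ) : ℝ) * (if nextState x d n = 0 then 1 else 0) +
        ((nextState x d n - τ n : ℕ) : ℝ) =
      (if τ n ≤ x n then 1 else 0) + ((x n - τ n : ℕ) : ℝ) := by
  have hstep : ((x n + 1 - τ n : ℕ) : ℝ) =
      (if τ n ≤ x n then 1 else 0) + ((x n - τ n : ℕ) : ℝ) := by
    split_ifs with h
    · rw [Nat.succ_sub h]; push_cast; ring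
    · rw [Nat.sub_eq_zero_of_le (by omega), Nat.sub_eq_zero_of_le (by omega)]; simp
  rw [← hstep]
  cases h : d n <;> simp [nextState, h]

/-- If the excess over the thresholds splits off the cost at horizon `T`, the recursion at
horizon `T + 1` can be written with the truncated next state. -/
lemma V_succ_eq {N : ℕ} (p : Fin N → ℝ) (τ : Fin N → ℕ) (E : Fin N → ℝ) (η : ℝ) (L T : ℕ)
    (hT : ∀ y, V p τ E η L T y =
      V p τ E η L T (fun n => min (y n) (τ n)) + ∑ n, ((y n - τ n : ℕ) : ℝ))
    (x : Fin N → ℕ) :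
    V p τ E η L (T + 1) x =
      (admissible N L).inf' (admissible_nonempty N L) (fun u =>
        η * ∑ n, E n * (if u n then 1 else 0) + ∑ n, (if τ n ≤ x n then (1 : ℝ) else 0) +
          ∑ d : Fin N → Bool, deliveryWeight p u d *
            V p τ E η L T (fun n => min (nextState x d n) (τ n))) +
        ∑ n, ((x n - τ n : ℕ) : ℝ) := by
  have hshift := map_finset_inf' (OrderIso.addRight (∑ n, ((x n - τ n : ℕ) : ℝ)))
    (admissible_nonempty N L) (fun u =>
        η * ∑ n, E n * (if u n then 1 else 0) + ∑ n, (if τ n ≤ x n then (1 : ℝ) else 0) +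
          ∑ d : Fin N → Bool, deliveryWeight p u d *
            V p τ E η L T (fun n => min (nextState x d n) (τ n)))
  rw [OrderIso.addRight_apply] at hshift
  rw [hshift, V]
  refine inf'_congr _ rfl fun u _ => ?_
  have hsummand : ∀ d : Fin N → Bool,
      (∑ n, ((x n + 1 - τ n : ℕ) : ℝ) * (if nextState x d n = 0 then 1 else 0)) +
          V p τ E η L T (nextState x d) =
        V p τ E η L T (fun n => min (nextState x d n) (τ n)) +
          (∑ n, (if τ n ≤ x n then (1 : ℝ) else 0) + ∑ n, ((x n - τ n : ℕ) : ℝ)) := by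
    intro d
    rw [hT (nextState x d), ← sum_add_distrib,
      ← sum_congr rfl fun n _ => charge_add_excess_nextState τ x d n, sum_add_distrib]
    ring
  simp only [hsummand, mul_add _ (V p τ E η L T _), sum_add_distrib, ← sum_mul,
    sum_deliveryWeight, Function.comp_apply, OrderIso.addRight_apply]
  ring

/-- The optimal cost is the optimal cost of the truncated state plus the total excess of the
state over the thresholds. -/
lemma V_eq_truncate_add_excess {N : ℕ} (p : Fin N → ℝ) (τ : Fin N → ℕ) (E : Fin N → ℝ)
    (η : ℝ) (L T : ℕ) (x : Fin N → ℕ) :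
    V p τ E η L T x =
      V p τ E η L T (fun n => min (x n) (τ n)) + ∑ n, ((x n - τ n : ℕ) : ℝ) := by
  induction T generalizing x with
  | zero => simp [V]
  | succ T ih =>
    have hnext : ∀ d : Fin N → Bool,
        (fun n => min (nextState (fun n => min (x n) (τ n)) d n) (τ n)) =
          fun n => min (nextState x d n) (τ n) := by
      intro d
      funext n
      cases h : d n
      · simp only [nextState, h, Bool.false_eq_true, if_false]
        omega
      · simp [nextState, h]
    rw [V_succ_eq p τ E η L T ih x, V_succ_eq p τ E η L T ih fun n => min (x n) (τ n)]
    simp [hnext]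

/-- for every horizon `T + 1 ≥ 1` and state `x` with `xₙ ≤ τₙ` for all `n`,
`V_{T+1}(x) = min over admissible u of [∑ₙ (η Eₙ uₙ + 1{xₙ = τₙ}) + E(V_T(Y ∧ τ))]`. -/
theorem statement3 (N : ℕ) (hN : 1 ≤ N) (L : ℕ) (hL1 : 1 ≤ L) (hLN : L ≤ N)
    (p : Fin N → ℝ) (hp : ∀ n, 0 < p n ∧ p n < 1)
    (τ : Fin N → ℕ) (hτ : ∀ n, 1 ≤ τ n)
    (E : Fin N → ℝ) (hE : ∀ n, 0 ≤ E n)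
    (η : ℝ) (hη : 0 ≤ η)
    (T : ℕ) (x : Fin N → ℕ) (hx : ∀ n, x n ≤ τ n) :
    V p τ E η L (T + 1) x =
      (admissible N L).inf' (admissible_nonempty N L) (fun u =>
        (∑ n, (η * E n * (if u n then 1 else 0) + (if x n = τ n then (1 : ℝ) else 0))) +
          ∑ d : Fin N → Bool, deliveryWeight p u d *
            V p τ E η L T (fun n => min (nextState x d n) (τ n))) := by
  rw [V_succ_eq p τ E η L T (V_eq_truncate_add_excess p τ E η L T)]
  have hexcess : ∑ n, ((x n - τ n : ℕ) : ℝ) = 0 :=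
    sum_eq_zero fun n _ => by simp [Nat.sub_eq_zero_of_le (hx n)]
  rw [hexcess, add_zero]
  refine inf'_congr _ rfl fun u _ => ?_
  have hiff : ∀ n, τ n ≤ x n ↔ x n = τ n := fun n => ⟨(hx n).antisymm, fun h => h.ge⟩
  simp only [hiff, sum_add_distrib, mul_sum, mul_assoc]
end

section
/- Let θ ∈ {0,…,τ} and define π : {0,…,τ} → ℝ by π(i) = p·(1−p)^{max(i−θ,0)}/(1+θp) for 0 ≤ i ≤ τ−1 and π(τ) = (1−p)^{τ−θ}/(1+θp). Then π is a probability distribution (π(i) ≥ 0 for all i and Σ_{i=0}^{τ} π(i) = 1) and π is stationary for the threshold-policy transition matrix P_θ, i.e. Σ_{i=0}^{τ} π(i)·P_θ(i,j) = π(j) for every j ∈ {0,…,τ}. -/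
open Finset

/-- Average reward `g(θ)` of the threshold policy `σ(θ,0)` in the `ω`-subsidy problem:
`g(θ) = (pθω − ηE − (1−p)^{τ−θ}) / (1 + θp)`. -/
noncomputable def avgReward (p : ℝ) (τ : ℕ) (E η ω : ℝ) (θ : ℕ) : ℝ :=
  (p * θ * ω - η * E - (1 - p) ^ (τ - θ)) / (1 + θ * p)

/-- The Whittle index `W(i) = p(i+1)(1−p)^{τ−(i+1)} − ηE` for `i ∈ {0,…,τ−1}`. -/
noncomputable def whittle (p : ℝ) (τ : ℕ) (E η : ℝ) (i : ℕ) : ℝ :=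
  p * (i + 1) * (1 - p) ^ (τ - (i + 1)) - η * E

/-- The candidate stationary distribution of the threshold policy `σ(θ,0)`:
`π(i) = p(1−p)^{max(i−θ,0)}/(1+θp)` for `0 ≤ i ≤ τ−1` and `π(τ) = (1−p)^{τ−θ}/(1+θp)`. -/
noncomputable def statDist (p : ℝ) (τ θ : ℕ) (i : ℕ) : ℝ :=
  if i = τ then (1 - p) ^ (τ - θ) / (1 + θ * p)
  else p * (1 - p) ^ (i - θ) / (1 + θ * p)

/-- Transition matrix of the threshold policy `σ(θ,0)` on `{0,…,τ}`: from `i < θ` move to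
`i+1` with probability 1; from `i ≥ θ` move to `0` with probability `p` and to
`min(i+1,τ)` with probability `1−p`. -/
noncomputable def Pthresh (p : ℝ) (τ θ : ℕ) (i j : ℕ) : ℝ :=
  if i < θ then (if j = i + 1 then 1 else 0)
  else (if j = 0 then p else 0) + (if j = min (i + 1) τ then 1 - p else 0)

/-- Partial sums of the unnormalised weights `p(1−p)^{max(i−θ,0)}`. -/
lemma sum_range_weight (p : ℝ) (θ k : ℕ) :
    ∑ i ∈ Finset.range (θ + k), p * (1 - p) ^ (i - θ) = θ * p + 1 - (1 - p) ^ k := by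
  induction k with
  | zero =>
    have h : ∀ i ∈ Finset.range θ, p * (1 - p) ^ (i - θ) = p := fun i hi => by
      rw [Nat.sub_eq_zero_of_le (Finset.mem_range.mp hi).le, pow_zero, mul_one]
    simp [Finset.sum_congr rfl h]
  | succ k ih =>
    rw [← add_assoc, Finset.sum_range_succ, ih, Nat.add_sub_cancel_left]
    ring

lemma statDist_of_lt (p : ℝ) {τ i : ℕ} (θ : ℕ) (hi : i < τ) :
    statDist p τ θ i = p * (1 - p) ^ (i - θ) / (1 + θ * p) :=
  if_neg hi.ne

lemma statDist_self (p : ℝ) (τ θ : ℕ) :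
    statDist p τ θ τ = (1 - p) ^ (τ - θ) / (1 + θ * p) :=
  if_pos rfl

lemma sum_range_statDist (p : ℝ) {n τ θ : ℕ} (hθ : θ ≤ n) (hn : n ≤ τ) :
    ∑ i ∈ Finset.range n, statDist p τ θ i =
      (θ * p + 1 - (1 - p) ^ (n - θ)) / (1 + θ * p) := by
  rw [← sum_range_weight, Nat.add_sub_cancel' hθ, Finset.sum_div]
  exact Finset.sum_congr rfl fun i hi =>
    statDist_of_lt p θ ((Finset.mem_range.mp hi).trans_le hn)

lemma sum_statDist {p : ℝ} (hp : 0 < p) {τ θ : ℕ} (hθ : θ ≤ τ) :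
    ∑ i ∈ Finset.range (τ + 1), statDist p τ θ i = 1 := by
  have hD : (1 + θ * p : ℝ) ≠ 0 := by positivity
  rw [Finset.sum_range_succ, sum_range_statDist p hθ le_rfl, statDist_self]
  field_simp
  ring

/-- The stationary equation at the state `0`. -/
lemma sum_statDist_mul_Pthresh_zero {p : ℝ} (hp : 0 < p) {τ θ : ℕ} (hτ : 1 ≤ τ) (hθ : θ ≤ τ) :
    ∑ i ∈ Finset.range (τ + 1), statDist p τ θ i * Pthresh p τ θ i 0 = statDist p τ θ 0 := by
  have hD : (1 + θ * p : ℝ) ≠ 0 := by positivity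
  have hP : ∀ i, Pthresh p τ θ i 0 = if i < θ then 0 else p := fun i => by
    have h : 0 ≠ min (i + 1) τ := by omega
    simp [Pthresh, h]
  have hlow : ∑ i ∈ Finset.range θ, statDist p τ θ i * Pthresh p τ θ i 0 = 0 :=
    Finset.sum_eq_zero fun i hi => by rw [hP, if_pos (Finset.mem_range.mp hi), mul_zero]
  have hhigh : ∑ i ∈ Finset.Ico θ (τ + 1), statDist p τ θ i * Pthresh p τ θ i 0 =
      (∑ i ∈ Finset.Ico θ (τ + 1), statDist p τ θ i) * p := by
    rw [Finset.sum_mul]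
    exact Finset.sum_congr rfl fun i hi => by
      rw [hP, if_neg (Finset.mem_Ico.mp hi).1.not_gt]
  rw [← Finset.sum_range_add_sum_Ico _ (hθ.trans τ.le_succ), hlow, hhigh,
    Finset.sum_Ico_eq_sub _ (hθ.trans τ.le_succ), sum_statDist hp hθ,
    sum_range_statDist p le_rfl hθ, statDist_of_lt p θ hτ, Nat.sub_self, Nat.zero_sub]
  field_simp
  ring

/-- The stationary equation at an intermediate state. -/
lemma sum_statDist_mul_Pthresh_succ (p : ℝ) {τ θ m : ℕ} (hm : m + 1 < τ) :
    ∑ i ∈ Finset.range (τ + 1), statDist p τ θ i * Pthresh p τ θ i (m + 1) =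
      statDist p τ θ (m + 1) := by
  rw [Finset.sum_eq_single m]
  · rw [statDist_of_lt p θ (by omega), statDist_of_lt p θ hm]
    by_cases h : m < θ
    · simp [Pthresh, h, Nat.sub_eq_zero_of_le h.le, Nat.sub_eq_zero_of_le (Nat.succ_le_of_lt h)]
    · rw [Nat.sub_add_comm (not_lt.mp h), pow_succ]
      simp only [Pthresh, if_neg h, if_neg m.succ_ne_zero, min_eq_left hm.le, if_true]
      ring
  · intro i _ hne
    have h₂ : m + 1 ≠ min (i + 1) τ := by omega
    simp [Pthresh, h₂, hne.symm]
  · intro h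
    exact absurd (Finset.mem_range.mpr (by omega)) h

/-- The stationary equation at the state `τ = t + 1`. -/
lemma sum_statDist_mul_Pthresh_last (p : ℝ) {t θ : ℕ} (hθ : θ ≤ t + 1) :
    ∑ i ∈ Finset.range (t + 1 + 1), statDist p (t + 1) θ i * Pthresh p (t + 1) θ i (t + 1) =
      statDist p (t + 1) θ (t + 1) := by
  have hzero : ∑ i ∈ Finset.range t, statDist p (t + 1) θ i * Pthresh p (t + 1) θ i (t + 1) = 0 :=
    Finset.sum_eq_zero fun i hi => by
      have hi := Finset.mem_range.mp hi
      have h₂ : t + 1 ≠ min (i + 1) (t + 1) := by omega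
      have h₃ : t ≠ i := hi.ne'
      simp only [Pthresh, Nat.add_right_cancel_iff, h₃, h₂, t.succ_ne_zero, if_false, add_zero,
        ite_self, mul_zero]
  rw [Finset.sum_range_succ, Finset.sum_range_succ, hzero, statDist_self,
    statDist_of_lt p θ t.lt_succ_self]
  by_cases h : t < θ
  · obtain rfl : θ = t + 1 := by omega
    simp [Pthresh]
    ring
  · rw [Nat.sub_add_comm (not_lt.mp h), pow_succ]
    simp only [Pthresh, if_neg h, if_neg hθ.not_gt, if_neg t.succ_ne_zero, min_self,
      min_eq_right (Nat.le_succ _), if_true]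
    ring

/-- `π` is a probability distribution on `{0,…,τ}` and is stationary for the
threshold-policy transition matrix `P_θ`. -/
theorem statement6 (p : ℝ) (hp0 : 0 < p) (hp1 : p < 1) (τ : ℕ) (hτ : 1 ≤ τ)
    (θ : ℕ) (hθ : θ ≤ τ) :
    (∀ i ∈ Finset.range (τ + 1), 0 ≤ statDist p τ θ i) ∧
    (∑ i ∈ Finset.range (τ + 1), statDist p τ θ i = 1) ∧
    (∀ j ∈ Finset.range (τ + 1),
      ∑ i ∈ Finset.range (τ + 1), statDist p τ θ i * Pthresh p τ θ i j =
        statDist p τ θ j) := by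
  refine ⟨fun i _ => ?_, sum_statDist hp0 hθ, fun j hj => ?_⟩
  · have hq : 0 < 1 - p := sub_pos.mpr hp1
    unfold statDist
    split_ifs <;> positivity
  · have hj := Finset.mem_range.mp hj
    cases j with
    | zero => exact sum_statDist_mul_Pthresh_zero hp0 hτ hθ
    | succ m =>
      rcases Nat.lt_or_ge (m + 1) τ with hm | hm
      · exact sum_statDist_mul_Pthresh_succ p hm
      · obtain rfl : τ = m + 1 := by omega
        exact sum_statDist_mul_Pthresh_last p hθ
end

section
/- Let θ ∈ {0,…,τ} and let π be the stationary distribution of the threshold policy σ(θ,0), namely π(i) = p·(1−p)^{max(i−θ,0)}/(1+θp) for 0 ≤ i ≤ τ−1 and π(τ) = (1−p)^{τ−θ}/(1+θp). Then the stationary expected one-step reward equals g(θ); that is, Σ_{i=0}^{τ} π(i)·( −1{i=τ} − ηE·1{i ≥ θ} + ω·1{i < θ} ) = (pθω − ηE − (1−p)^{τ−θ})/(1 + θp). -/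
open Finset

/-- The geometric tail `∑_{j<k} p(1−p)^j` equals `1 − (1−p)^k`. -/
theorem sum_range_mul_one_sub_pow (p : ℝ) (k : ℕ) :
    ∑ j ∈ Finset.range k, p * (1 - p) ^ j = 1 - (1 - p) ^ k := by
  rw [← Finset.mul_sum]
  simpa using mul_neg_geom_sum (1 - p) k

/-- the stationary expected one-step reward of the threshold policy `σ(θ,0)`
equals `g(θ) = (pθω − ηE − (1−p)^{τ−θ})/(1 + θp)`; the one-step reward in state `i` is
`−1{i=τ} − ηE·1{i ≥ θ} + ω·1{i < θ}`. -/
theorem statement7 (p : ℝ) (hp0 : 0 < p) (hp1 : p < 1) (τ : ℕ) (hτ : 1 ≤ τ)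
    (E η ω : ℝ) (hE : 0 ≤ E) (hη : 0 ≤ η)
    (θ : ℕ) (hθ : θ ≤ τ) :
    ∑ i ∈ Finset.range (τ + 1), statDist p τ θ i *
        (-(if i = τ then (1 : ℝ) else 0) - η * E * (if θ ≤ i then 1 else 0) +
          ω * (if i < θ then 1 else 0)) =
      (p * θ * ω - η * E - (1 - p) ^ (τ - θ)) / (1 + θ * p) := by
  obtain ⟨k, rfl⟩ := Nat.exists_eq_add_of_le hθ
  have passive : ∀ i ∈ Finset.range θ, statDist p (θ + k) θ i *
      (-(if i = θ + k then (1 : ℝ) else 0) - η * E * (if θ ≤ i then 1 else 0) +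
        ω * (if i < θ then 1 else 0)) = p * ω / (1 + θ * p) := by
    intro i hi
    have hi : i < θ := Finset.mem_range.mp hi
    rw [statDist, if_neg (by lia), if_neg (by lia), if_neg (by lia), if_pos hi,
      Nat.sub_eq_zero_of_le hi.le]
    ring
  have active : ∀ j ∈ Finset.range k, statDist p (θ + k) θ (θ + j) *
      (-(if θ + j = θ + k then (1 : ℝ) else 0) - η * E * (if θ ≤ θ + j then 1 else 0) +
        ω * (if θ + j < θ then 1 else 0)) =
      p * (1 - p) ^ j * (-(η * E) / (1 + θ * p)) := by
    intro j hj
    have hj : j < k := Finset.mem_range.mp hj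
    rw [statDist, if_neg (by lia), if_neg (by lia), if_pos (by lia), if_neg (by lia),
      Nat.add_sub_cancel_left]
    ring
  rw [Finset.sum_range_succ, Finset.sum_range_add, Finset.sum_congr rfl passive,
    Finset.sum_congr rfl active, ← Finset.sum_mul, sum_range_mul_one_sub_pow,
    Finset.sum_const, Finset.card_range, nsmul_eq_mul, statDist, if_pos rfl, if_pos rfl,
    if_pos hθ, if_neg (by lia), Nat.add_sub_cancel_left]
  ring
end

section
/- For every θ ∈ {0,…,τ−1}, the difference of average rewards of consecutive threshold policies satisfies the exact identity g(θ+1) − g(θ) = p·(ω − W(θ)) / ( (1+θp)·(1+(θ+1)p) ). In particular g(θ+1) > g(θ) if and only if ω > W(θ), and g(θ+1) = g(θ) if and only if ω = W(θ). -/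
open Finset

/-- for every `θ ∈ {0,…,τ−1}`,
`g(θ+1) − g(θ) = p(ω − W(θ)) / ((1+θp)(1+(θ+1)p))`; in particular `g(θ+1) > g(θ)` iff
`ω > W(θ)`, and `g(θ+1) = g(θ)` iff `ω = W(θ)`. -/
theorem statement8 (p : ℝ) (hp0 : 0 < p) (hp1 : p < 1) (τ : ℕ) (hτ : 1 ≤ τ)
    (E η ω : ℝ) (hE : 0 ≤ E) (hη : 0 ≤ η)
    (θ : ℕ) (hθ : θ < τ) :
    avgReward p τ E η ω (θ + 1) - avgReward p τ E η ω θ =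
        p * (ω - whittle p τ E η θ) / ((1 + θ * p) * (1 + (θ + 1 : ℕ) * p)) ∧
      (avgReward p τ E η ω θ < avgReward p τ E η ω (θ + 1) ↔ whittle p τ E η θ < ω) ∧
      (avgReward p τ E η ω (θ + 1) = avgReward p τ E η ω θ ↔ ω = whittle p τ E η θ) := by
  have h₁ : 0 < 1 + (θ : ℝ) * p := by positivity
  have h₂ : 0 < 1 + ((θ + 1 : ℕ) : ℝ) * p := by positivity
  have hpow : (1 - p) ^ (τ - θ) = (1 - p) * (1 - p) ^ (τ - (θ + 1)) := by
    rw [← pow_succ']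
    congr 1
    omega
  have key : avgReward p τ E η ω (θ + 1) - avgReward p τ E η ω θ =
      p * (ω - whittle p τ E η θ) / ((1 + θ * p) * (1 + (θ + 1 : ℕ) * p)) := by
    unfold avgReward whittle
    rw [hpow, div_sub_div _ _ h₂.ne' h₁.ne', mul_comm (1 + (θ : ℝ) * p) (1 + _ * p)]
    congr 1
    push_cast
    ring
  refine ⟨key, ?_, ?_⟩
  · rw [← sub_pos, key, div_pos_iff_of_pos_right (mul_pos h₁ h₂), mul_pos_iff_of_pos_left hp0,
      sub_pos]
  · rw [← sub_eq_zero, key, div_eq_zero_iff, or_iff_left (mul_pos h₁ h₂).ne',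
      mul_eq_zero_iff_left hp0.ne', sub_eq_zero]
end

section
/- Let θ* ∈ {0,…,τ−1} and suppose ω ≤ W(θ*) and, if θ* ≥ 1, also W(θ*−1) ≤ ω. Then the threshold policy σ(θ*,0) is best among all threshold policies and the always-passive policy: g(θ*) ≥ g(θ) for every θ ∈ {0,…,τ}, and g(θ*) ≥ ω − 1. -/
open Finset

lemma avgReward_succ_sub {p : ℝ} (hp : 0 < p) {τ θ : ℕ} (E η ω : ℝ) (hθ : θ < τ) :
    avgReward p τ E η ω (θ + 1) - avgReward p τ E η ω θ =
      p * (ω - whittle p τ E η θ) / ((1 + (θ + 1) * p) * (1 + θ * p)) := by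
  obtain ⟨k, rfl⟩ := Nat.exists_eq_add_of_lt hθ
  have h₁ : θ + k + 1 - θ = k + 1 := by omega
  have h₂ : θ + k + 1 - (θ + 1) = k := by omega
  have h₃ : (1 + θ * p) ≠ 0 := by positivity
  have h₄ : (1 + (θ + 1) * p) ≠ 0 := by positivity
  simp only [avgReward, whittle, h₁, h₂, Nat.cast_add, Nat.cast_one]
  rw [div_sub_div _ _ h₄ h₃]
  congr 1
  ring

lemma avgReward_le_succ {p : ℝ} (hp : 0 < p) {τ θ : ℕ} {E η ω : ℝ} (hθ : θ < τ)
    (h : whittle p τ E η θ ≤ ω) :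
    avgReward p τ E η ω θ ≤ avgReward p τ E η ω (θ + 1) := by
  rw [← sub_nonneg, avgReward_succ_sub hp E η ω hθ]
  have := sub_nonneg.2 h
  positivity

lemma avgReward_succ_le {p : ℝ} (hp : 0 < p) {τ θ : ℕ} {E η ω : ℝ} (hθ : θ < τ)
    (h : ω ≤ whittle p τ E η θ) :
    avgReward p τ E η ω (θ + 1) ≤ avgReward p τ E η ω θ := by
  rw [← sub_nonpos, avgReward_succ_sub hp E η ω hθ]
  exact div_nonpos_of_nonpos_of_nonneg
    (mul_nonpos_of_nonneg_of_nonpos hp.le (sub_nonpos.2 h)) (by positivity)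

lemma whittle_le_whittle {p : ℝ} (hp0 : 0 < p) (hp1 : p < 1) {τ i j : ℕ} (E η : ℝ)
    (hij : i ≤ j) : whittle p τ E η i ≤ whittle p τ E η j := by
  have hq : 0 ≤ 1 - p := by linarith
  have hpow : (1 - p) ^ (τ - (i + 1)) ≤ (1 - p) ^ (τ - (j + 1)) :=
    pow_le_pow_of_le_one hq (by linarith) (by omega)
  unfold whittle
  gcongr

lemma sub_one_le_avgReward {p : ℝ} (hp0 : 0 < p) (hp1 : p < 1) {τ θ : ℕ} {E η ω : ℝ}
    (hθ : θ < τ) (h : ω ≤ whittle p τ E η θ) : ω - 1 ≤ avgReward p τ E η ω θ := by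
  obtain ⟨k, rfl⟩ := Nat.exists_eq_add_of_lt hθ
  have h₁ : θ + k + 1 - θ = k + 1 := by omega
  have h₂ : θ + k + 1 - (θ + 1) = k := by omega
  have hD : 0 < 1 + θ * p := by positivity
  have hpow : (1 - p) ^ k ≤ 1 := pow_le_one₀ (by linarith) (by linarith)
  simp only [whittle, h₂] at h
  rw [avgReward, h₁, le_div_iff₀ hD, pow_succ]
  linarith [mul_le_mul_of_nonneg_left hpow hD.le]

/-- if `θ* ∈ {0,…,τ−1}`, `ω ≤ W(θ*)` and (when `θ* ≥ 1`) `W(θ*−1) ≤ ω`,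
then the threshold policy `σ(θ*,0)` is best among all threshold policies and the
always-passive policy: `g(θ*) ≥ g(θ)` for every `θ ∈ {0,…,τ}`, and `g(θ*) ≥ ω − 1`. -/
theorem statement11 (p : ℝ) (hp0 : 0 < p) (hp1 : p < 1) (τ : ℕ) (hτ : 1 ≤ τ)
    (E η ω : ℝ) (hE : 0 ≤ E) (hη : 0 ≤ η)
    (θs : ℕ) (hθs : θs < τ)
    (hub : ω ≤ whittle p τ E η θs)
    (hlb : 1 ≤ θs → whittle p τ E η (θs - 1) ≤ ω) :
    (∀ θ : ℕ, θ ≤ τ → avgReward p τ E η ω θ ≤ avgReward p τ E η ω θs) ∧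
      ω - 1 ≤ avgReward p τ E η ω θs := by
  refine ⟨fun θ hθ => ?_, sub_one_le_avgReward hp0 hp1 hθs hub⟩
  rcases le_total θ θs with hle | hle
  · have key : ∀ n, θ ≤ n → n ≤ θs → avgReward p τ E η ω θ ≤ avgReward p τ E η ω n := by
      intro n hn
      induction n, hn using Nat.le_induction with
      | base => exact fun _ => le_rfl
      | succ n _ ih =>
        intro hns
        exact (ih (by omega)).trans (avgReward_le_succ hp0 (by omega)
          ((whittle_le_whittle hp0 hp1 E η (by omega)).trans (hlb (by omega))))
    exact key θs hle le_rfl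
  · induction θ, hle using Nat.le_induction with
    | base => exact le_rfl
    | succ n hn ih =>
      exact (avgReward_succ_le hp0 (by omega)
        (hub.trans (whittle_le_whittle hp0 hp1 E η hn))).trans (ih (by omega))
end

section
/- If ω ≥ W(τ−1) = pτ − ηE, then the always-passive policy is best among all threshold policies: ω − 1 ≥ g(θ) for every θ ∈ {0,…,τ}. -/
open Finset

/-- if `ω ≥ W(τ−1) = pτ − ηE` then the always-passive policy is best among
all threshold policies: `ω − 1 ≥ g(θ)` for every `θ ∈ {0,…,τ}`. -/
theorem statement12 (p : ℝ) (hp0 : 0 < p) (hp1 : p < 1) (τ : ℕ) (hτ : 1 ≤ τ)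
    (E η ω : ℝ) (hE : 0 ≤ E) (hη : 0 ≤ η)
    (hω : p * τ - η * E ≤ ω) :
    ∀ θ : ℕ, θ ≤ τ → avgReward p τ E η ω θ ≤ ω - 1 := by
  intro θ hθ
  have bernoulli := one_add_mul_le_pow (by linarith : (-2 : ℝ) ≤ -p) (τ - θ)
  rw [Nat.cast_sub hθ, ← sub_eq_add_neg] at bernoulli
  rw [avgReward, div_le_iff₀ (by positivity)]
  linarith
end

section
/- Let θ ∈ {0,…,τ−1} and suppose ω ≤ W(θ) and, if θ ≥ 1, also W(θ−1) ≤ ω. Then there exists a relative value function f : {0,…,τ} → ℝ with f(0) = 0 such that the average-reward optimality equation holds with constant g(θ): for every state i ∈ {0,…,τ}, g(θ) + f(i) = max over u ∈ {0,1} of [ −1{i=τ} − ηEu + ω(1−u) + p·u·f(0) + (1 − p·u)·f(min(i+1, τ)) ], and the maximum at state i is attained by u = 1{i ≥ θ} (the action of the threshold policy σ(θ,0)). -/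
open Finset

/-- The right-hand side of the average-reward optimality equation at state `i` for action
`u` (as a real, `u = 1` active, `u = 0` passive), given a relative value function `f`:
`−1{i=τ} − ηEu + ω(1−u) + p·u·f(0) + (1 − p·u)·f(min(i+1,τ))`. -/
noncomputable def dpRHS (p : ℝ) (τ : ℕ) (E η ω : ℝ) (f : ℕ → ℝ) (i : ℕ) (u : ℝ) : ℝ :=
  -(if i = τ then (1 : ℝ) else 0) - η * E * u + ω * (1 - u) +
    p * u * f 0 + (1 - p * u) * f (min (i + 1) τ)

/-- The defining equation of `avgReward`, cleared of its denominator. -/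
lemma avgReward_mul_eq {p : ℝ} (hp : 0 < p) (τ : ℕ) (E η ω : ℝ) (θ : ℕ) :
    avgReward p τ E η ω θ * (1 + θ * p) = p * θ * ω - η * E - (1 - p) ^ (τ - θ) := by
  have : (0 : ℝ) < 1 + θ * p := by positivity
  rw [avgReward, div_mul_cancel₀ _ this.ne']

/-- Below the upper index bound, the subsidy is small enough for activity at the threshold. -/
lemma le_avgReward_add_pow {p : ℝ} (hp : 0 < p) {τ : ℕ} {E η ω : ℝ} {θ : ℕ} (hθ : θ < τ)
    (h : ω ≤ whittle p τ E η θ) :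
    ω ≤ avgReward p τ E η ω θ + (1 - p) ^ (τ - (θ + 1)) := by
  have hg := avgReward_mul_eq hp τ E η ω θ
  have hpos : (0 : ℝ) < 1 + θ * p := by positivity
  have hpow : (1 - p) ^ (τ - θ) = (1 - p) ^ (τ - (θ + 1)) * (1 - p) := by
    rw [← pow_succ]
    congr 1
    omega
  rw [whittle] at h
  rw [hpow] at hg
  refine le_of_mul_le_mul_right ?_ hpos
  linarith

/-- Above the lower index bound, the subsidy is large enough for passivity just below the
threshold. -/
lemma avgReward_add_pow_le {p : ℝ} (hp : 0 < p) {τ : ℕ} {E η ω : ℝ} {θ : ℕ} (hθ : 1 ≤ θ)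
    (h : whittle p τ E η (θ - 1) ≤ ω) :
    avgReward p τ E η ω θ + (1 - p) ^ (τ - θ) ≤ ω := by
  have hg := avgReward_mul_eq hp τ E η ω θ
  have hpos : (0 : ℝ) < 1 + θ * p := by positivity
  rw [whittle, Nat.sub_add_cancel hθ, Nat.cast_sub hθ, Nat.cast_one, sub_add_cancel] at h
  refine le_of_mul_le_mul_right ?_ hpos
  linarith

/-- The relative value function of the threshold policy. -/
noncomputable def relValue (p : ℝ) (τ : ℕ) (E η ω : ℝ) (θ i : ℕ) : ℝ :=
  if i ≤ θ then i * (avgReward p τ E η ω θ - ω)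
  else -(η * E + avgReward p τ E η ω θ + (1 - p) ^ (τ - i)) / p

lemma relValue_of_le {p : ℝ} {τ : ℕ} {E η ω : ℝ} {θ i : ℕ} (h : i ≤ θ) :
    relValue p τ E η ω θ i = i * (avgReward p τ E η ω θ - ω) := if_pos h

lemma mul_relValue_of_ge {p : ℝ} (hp : 0 < p) {τ : ℕ} {E η ω : ℝ} {θ i : ℕ} (h : θ ≤ i) :
    p * relValue p τ E η ω θ i =
      -(η * E + avgReward p τ E η ω θ + (1 - p) ^ (τ - i)) := by
  rcases h.eq_or_lt with rfl | h
  · rw [relValue_of_le le_rfl]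
    linarith [avgReward_mul_eq hp τ E η ω θ]
  · rw [relValue, if_neg h.not_ge, mul_div_cancel₀ _ hp.ne']

/-- if `θ ∈ {0,…,τ−1}`, `ω ≤ W(θ)` and (when `θ ≥ 1`) `W(θ−1) ≤ ω`, then
there exists a relative value function `f` with `f(0) = 0` satisfying the average-reward
optimality equation with constant `g(θ)`, the maximum at state `i` being attained by the
threshold action `u = 1{i ≥ θ}`. -/
theorem statement13 (p : ℝ) (hp0 : 0 < p) (hp1 : p < 1) (τ : ℕ) (hτ : 1 ≤ τ)
    (E η ω : ℝ) (hE : 0 ≤ E) (hη : 0 ≤ η)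
    (θ : ℕ) (hθ : θ < τ)
    (hub : ω ≤ whittle p τ E η θ)
    (hlb : 1 ≤ θ → whittle p τ E η (θ - 1) ≤ ω) :
    ∃ f : ℕ → ℝ, f 0 = 0 ∧ ∀ i : ℕ, i ≤ τ →
      (avgReward p τ E η ω θ + f i =
          max (dpRHS p τ E η ω f i 0) (dpRHS p τ E η ω f i 1)) ∧
      avgReward p τ E η ω θ + f i =
        dpRHS p τ E η ω f i (if θ ≤ i then 1 else 0) := by
  refine ⟨relValue p τ E η ω θ, by simp [relValue], fun i hi => ?_⟩
  have hf0 : relValue p τ E η ω θ 0 = 0 := by simp [relValue]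
  rcases le_or_gt θ i with h | h
  · have hval : avgReward p τ E η ω θ + relValue p τ E η ω θ i =
        dpRHS p τ E η ω (relValue p τ E η ω θ) i 1 := by
      refine mul_left_cancel₀ hp0.ne' ?_
      have hfi := mul_relValue_of_ge hp0 (τ := τ) (E := E) (η := η) (ω := ω) h
      rw [dpRHS, hf0]
      rcases hi.eq_or_lt with rfl | hlt
      · rw [min_eq_right (Nat.le_succ i), if_pos rfl]
        rw [Nat.sub_self, pow_zero] at hfi
        linear_combination p * hfi
      · have hfs := mul_relValue_of_ge hp0 (τ := τ) (E := E) (η := η) (ω := ω)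
          (h.trans (Nat.le_succ i))
        have hpow : (1 - p) ^ (τ - i) = (1 - p) ^ (τ - (i + 1)) * (1 - p) := by
          rw [← pow_succ]
          congr 1
          omega
        rw [hpow] at hfi
        rw [min_eq_left hlt, if_neg hlt.ne]
        linear_combination hfi - (1 - p) * hfs
    have hle : dpRHS p τ E η ω (relValue p τ E η ω θ) i 0 ≤
        dpRHS p τ E η ω (relValue p τ E η ω θ) i 1 := by
      have hm : θ + 1 ≤ min (i + 1) τ := by omega
      have hfs := mul_relValue_of_ge hp0 (τ := τ) (E := E) (η := η) (ω := ω)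
        ((Nat.le_succ θ).trans hm)
      have hpow : (1 - p) ^ (τ - (θ + 1)) ≤ (1 - p) ^ (τ - min (i + 1) τ) :=
        pow_le_pow_of_le_one (by linarith) (by linarith) (by omega)
      have := le_avgReward_add_pow hp0 hθ hub
      rw [dpRHS, dpRHS, hf0]
      linarith
    rw [if_pos h, max_eq_right hle]
    exact ⟨hval, hval⟩
  · have hs : min (i + 1) τ = i + 1 := by omega
    have hfs := relValue_of_le (p := p) (τ := τ) (E := E) (η := η) (ω := ω) (Nat.succ_le_of_lt h)
    rw [Nat.succ_eq_add_one, Nat.cast_add_one] at hfs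
    have hval : avgReward p τ E η ω θ + relValue p τ E η ω θ i =
        dpRHS p τ E η ω (relValue p τ E η ω θ) i 0 := by
      rw [dpRHS, hs, hfs, relValue_of_le h.le, if_neg (by omega)]
      ring
    have hle : dpRHS p τ E η ω (relValue p τ E η ω θ) i 1 ≤
        dpRHS p τ E η ω (relValue p τ E η ω θ) i 0 := by
      have hθ1 : 1 ≤ θ := by omega
      have hlow := avgReward_add_pow_le hp0 hθ1 (hlb hθ1)
      have hpow : 0 ≤ (1 - p) ^ (τ - θ) := pow_nonneg (by linarith) _
      have hfθ := mul_relValue_of_ge hp0 (τ := τ) (E := E) (η := η) (ω := ω) (le_refl θ)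
      rw [relValue_of_le le_rfl] at hfθ
      have hiθ : (i : ℝ) + 1 ≤ θ := by exact_mod_cast h
      have hmono : (θ - (i + 1) : ℝ) * (p * (ω - avgReward p τ E η ω θ)) ≥ 0 :=
        mul_nonneg (by linarith) (mul_nonneg hp0.le (by linarith))
      rw [dpRHS, dpRHS, hs, hfs, hf0]
      linarith
    rw [if_neg h.not_ge, max_eq_left hle]
    exact ⟨hval, hval⟩
end

section
/- If ω ≥ W(τ−1) = pτ − ηE, then there exists a relative value function f : {0,…,τ} → ℝ with f(0) = 0 such that the average-reward optimality equation holds with constant ω − 1: for every state i ∈ {0,…,τ}, (ω − 1) + f(i) = max over u ∈ {0,1} of [ −1{i=τ} − ηEu + ω(1−u) + p·u·f(0) + (1 − p·u)·f(min(i+1, τ)) ], and the maximum at every state is attained by the passive action u = 0 (so the always-passive policy σ(τ,1) is optimal). -/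
open Finset

/-- if `ω ≥ W(τ−1) = pτ − ηE`, then there exists a relative value function
`f` with `f(0) = 0` satisfying the average-reward optimality equation with constant
`ω − 1`, the maximum at every state being attained by the passive action `u = 0`
(so the always-passive policy `σ(τ,1)` is optimal). -/
theorem statement14 (p : ℝ) (hp0 : 0 < p) (hp1 : p < 1) (τ : ℕ) (hτ : 1 ≤ τ)
    (E η ω : ℝ) (hE : 0 ≤ E) (hη : 0 ≤ η)
    (hω : p * τ - η * E ≤ ω) :
    ∃ f : ℕ → ℝ, f 0 = 0 ∧ ∀ i : ℕ, i ≤ τ →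
      ((ω - 1) + f i = max (dpRHS p τ E η ω f i 0) (dpRHS p τ E η ω f i 1)) ∧
      (ω - 1) + f i = dpRHS p τ E η ω f i 0 := by
  refine ⟨fun i => -(i : ℝ), by simp, fun i hi => ?_⟩
  have passive : (ω - 1) + -(i : ℝ) = dpRHS p τ E η ω (fun i => -(i : ℝ)) i 0 := by
    rcases hi.eq_or_lt with rfl | h
    · simp [dpRHS]
      ring
    · rw [dpRHS, if_neg h.ne, min_eq_left (Nat.succ_le_of_lt h)]
      push_cast
      ring
  refine ⟨?_, passive⟩
  rw [max_eq_left, ← passive]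
  rw [← passive]
  rcases hi.eq_or_lt with rfl | h
  · simp [dpRHS]
    linarith
  · rw [dpRHS, if_neg h.ne, min_eq_left (Nat.succ_le_of_lt h)]
    have hle : ((i + 1 : ℕ) : ℝ) ≤ τ := by exact_mod_cast h
    have hmul := mul_le_mul_of_nonneg_left hle hp0.le
    push_cast at hmul ⊢
    linarith
end

section
/- For every stationary deterministic policy a : {0,…,τ} → {0,1}, the induced transition matrix P_a forms a unichain with state τ reachable from every state: for every i ∈ {0,…,τ}, the τ-step transition probability satisfies (P_a^τ)(i, τ) ≥ (1−p)^τ > 0. -/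
open Finset

/-- Transition matrix on `{0,…,τ}` induced by a stationary deterministic policy
`a : {0,…,τ} → {0,1}`: from state `i`, move to `0` with probability `p·a(i)` and to
`min(i+1,τ)` with probability `1 − p·a(i)`. -/
noncomputable def polMatrix (p : ℝ) (τ : ℕ) (a : Fin (τ + 1) → Bool) :
    Matrix (Fin (τ + 1)) (Fin (τ + 1)) ℝ := fun i j =>
  (if (j : ℕ) = 0 then p * (if a i then 1 else 0) else 0) +
    (if (j : ℕ) = min ((i : ℕ) + 1) τ then 1 - p * (if a i then 1 else 0) else 0)

theorem polMatrix_nonneg {p : ℝ} (hp0 : 0 ≤ p) (hp1 : p ≤ 1) (τ : ℕ)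
    (a : Fin (τ + 1) → Bool) (i j : Fin (τ + 1)) : 0 ≤ polMatrix p τ a i j := by
  unfold polMatrix
  have h : 0 ≤ 1 - p := sub_nonneg.mpr hp1
  cases a i <;> split_ifs <;> simp_all

theorem polMatrix_pow_nonneg {p : ℝ} (hp0 : 0 ≤ p) (hp1 : p ≤ 1) (τ : ℕ)
    (a : Fin (τ + 1) → Bool) (n : ℕ) (i j : Fin (τ + 1)) :
    0 ≤ (polMatrix p τ a ^ n) i j := by
  induction n generalizing i with
  | zero => rw [pow_zero, Matrix.one_apply]; split_ifs <;> norm_num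
  | succ n ih =>
    rw [pow_succ', Matrix.mul_apply]
    exact Finset.sum_nonneg fun k _ => mul_nonneg (polMatrix_nonneg hp0 hp1 τ a i k) (ih k)

theorem one_sub_le_polMatrix_succ {p : ℝ} (hp0 : 0 ≤ p) (τ : ℕ)
    (a : Fin (τ + 1) → Bool) (i j : Fin (τ + 1)) (hj : (j : ℕ) = min ((i : ℕ) + 1) τ) :
    1 - p ≤ polMatrix p τ a i j := by
  unfold polMatrix
  rw [if_pos hj]
  cases a i <;> split_ifs <;> simp_all

/-- Following only failures, `n` steps lead from `i` to `min (i + n) τ`. -/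
theorem one_sub_pow_le_polMatrix_pow {p : ℝ} (hp0 : 0 ≤ p) (hp1 : p ≤ 1) (τ : ℕ)
    (a : Fin (τ + 1) → Bool) (n : ℕ) (i j : Fin (τ + 1))
    (hj : (j : ℕ) = min ((i : ℕ) + n) τ) :
    (1 - p) ^ n ≤ (polMatrix p τ a ^ n) i j := by
  induction n generalizing i with
  | zero =>
    have hij : i = j := Fin.ext (by omega)
    simp [hij]
  | succ n ih =>
    let k : Fin (τ + 1) := ⟨min ((i : ℕ) + 1) τ, by omega⟩
    have hk : (k : ℕ) = min ((i : ℕ) + 1) τ := rfl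
    rw [pow_succ', pow_succ', Matrix.mul_apply]
    calc (1 - p) * (1 - p) ^ n ≤ polMatrix p τ a i k * (polMatrix p τ a ^ n) k j :=
          mul_le_mul (one_sub_le_polMatrix_succ hp0 τ a i k hk) (ih k (by omega))
            (pow_nonneg (sub_nonneg.mpr hp1) n) (polMatrix_nonneg hp0 hp1 τ a i k)
      _ ≤ ∑ l, polMatrix p τ a i l * (polMatrix p τ a ^ n) l j :=
          Finset.single_le_sum
            (f := fun l => polMatrix p τ a i l * (polMatrix p τ a ^ n) l j)
            (fun l _ => mul_nonneg (polMatrix_nonneg hp0 hp1 τ a i l)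
              (polMatrix_pow_nonneg hp0 hp1 τ a n l j)) (Finset.mem_univ k)

/-- for every stationary deterministic policy `a`, the induced chain is a
unichain with state `τ` reachable from every state: for every state `i`, the `τ`-step
transition probability to state `τ` satisfies `(P_a^τ)(i,τ) ≥ (1−p)^τ > 0`. -/
theorem statement15 (p : ℝ) (hp0 : 0 < p) (hp1 : p < 1) (τ : ℕ) (hτ : 1 ≤ τ)
    (a : Fin (τ + 1) → Bool) (i : Fin (τ + 1)) :
    (1 - p) ^ τ ≤ (polMatrix p τ a ^ τ) i ⟨τ, Nat.lt_succ_self τ⟩ ∧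
      (0 : ℝ) < (1 - p) ^ τ := by
  exact ⟨one_sub_pow_le_polMatrix_pow hp0.le hp1.le τ a τ i _ (by simp),
    pow_pos (sub_pos.mpr hp1) τ⟩
end
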